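/- arXiv:hep-th/9404168 — 3 statements merged into one kernel-verified Lean document; each statement's English description precedes it below -/
import Mathlib

section
/- Let 𝔤 be a finite-dimensional Lie algebra over a field k of characteristic zero and let r ∈ 𝔤 ⊗ 𝔤. Define linear maps r₊ : 𝔤* → 𝔤 by r₊(ξ) = (ξ ⊗ id)(r) and r₋ : 𝔤* → 𝔤 by r₋(ξ) = −(id ⊗ ξ)(r), and define a bracket on 𝔤* by [ξ,η]_* = ad*_{r₊(ξ)} η − ad*_{r₋(η)} ξ, where (ad*_X ξ)(Y) = −ξ([X,Y]). Assume (i) r satisfies the classical Yang–Baxter equation [r₁₂,r₁₃] + [r₁₂,r₂₃] + [r₁₃,r₂₃] = 0 in 𝔤 ⊗ 𝔤 ⊗ 𝔤, and (ii) the symmetric part r + P(r) (P the flip of 𝔤 ⊗ 𝔤) is invariant under the adjoint action, i.e. (ad_X ⊗ id + id ⊗ ad_X)(r + P(r)) = 0 for all X ∈ 𝔤. Then r₊ and r₋ both preserve brackets: r₊([ξ,η]_*) = [r₊(ξ), r₊(η)] and r₋([ξ,η]_*) = [r₋(ξ), r₋(η)] for all ξ, η ∈ 𝔤*. -/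
open TensorProduct

variable (k : Type*) [Field k] [CharZero k]
variable (L : Type*) [LieRing L] [LieAlgebra k L] [FiniteDimensional k L]

/-- `r₊ : 𝔤* → 𝔤`, `ξ ↦ (ξ ⊗ id)(r)`. -/
noncomputable def rPlus (r : L ⊗[k] L) (ξ : Module.Dual k L) : L :=
  TensorProduct.lid k L (TensorProduct.map ξ LinearMap.id r)

/-- `r₋ : 𝔤* → 𝔤`, `ξ ↦ -(id ⊗ ξ)(r)`. -/
noncomputable def rMinus (r : L ⊗[k] L) (ξ : Module.Dual k L) : L :=
  - TensorProduct.rid k L (TensorProduct.map LinearMap.id ξ r)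

/-- The coadjoint action: `(ad*_X ξ)(Y) = -ξ ⁅X, Y⁆`. -/
def coad (X : L) (ξ : Module.Dual k L) : Module.Dual k L :=
  - (ξ ∘ₗ (LieAlgebra.ad k L X : L →ₗ[k] L))

/-- The dual bracket `[ξ,η]_* = ad*_{r₊ ξ} η - ad*_{r₋ η} ξ` on `𝔤*`. -/
noncomputable def dualBracket (r : L ⊗[k] L) (ξ η : Module.Dual k L) : Module.Dual k L :=
  coad k L (rPlus k L r ξ) η - coad k L (rMinus k L r η) ξ

/-- `r₊` in coordinates: `r₊ ξ = ∑ ξ(aᵢ) bᵢ`. -/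
theorem rPlus_sum_tmul {ι : Type*} [Fintype ι] (a b : ι → L) (ξ : Module.Dual k L) :
    rPlus k L (∑ i, a i ⊗ₜ[k] b i) ξ = ∑ i, ξ (a i) • b i := by
  simp [rPlus]

/-- `r₋` in coordinates: `r₋ ξ = -∑ ξ(bᵢ) aᵢ`. -/
theorem rMinus_sum_tmul {ι : Type*} [Fintype ι] (a b : ι → L) (ξ : Module.Dual k L) :
    rMinus k L (∑ i, a i ⊗ₜ[k] b i) ξ = -∑ i, ξ (b i) • a i := by
  simp [rMinus]

/-- The dual bracket in coordinates. -/
theorem dualBracket_sum_tmul_apply {ι : Type*} [Fintype ι] (a b : ι → L)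
    (ξ η : Module.Dual k L) (Y : L) :
    dualBracket k L (∑ i, a i ⊗ₜ[k] b i) ξ η Y
      = -∑ i, (ξ (a i) * η ⁅b i, Y⁆ + η (b i) * ξ ⁅a i, Y⁆) := by
  simp only [dualBracket, coad, rPlus_sum_tmul, rMinus_sum_tmul, LinearMap.sub_apply,
    LinearMap.neg_apply, LinearMap.comp_apply, LieAlgebra.ad_apply,
    map_neg, map_sum, map_smul, smul_eq_mul, LinearMap.sum_apply, LinearMap.smul_apply, neg_neg,
    Finset.sum_add_distrib]
  rw [sub_eq_add_neg, neg_add]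

/-- If `r = ∑ aᵢ ⊗ bᵢ ∈ 𝔤 ⊗ 𝔤` satisfies the classical Yang–Baxter equation
`[r₁₂,r₁₃] + [r₁₂,r₂₃] + [r₁₃,r₂₃] = 0` and its symmetric part `r + P(r)` is
`ad`-invariant, then `r₊` and `r₋` are Lie algebra homomorphisms from
`(𝔤*, [·,·]_*)` to `𝔤`. -/
theorem rPlus_rMinus_lie_homomorphisms (r : L ⊗[k] L)
    (ι : Type*) [Fintype ι] (a b : ι → L)
    (hr : r = ∑ i, a i ⊗ₜ[k] b i)
    (hCYBE : ∑ i, ∑ j,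
        ((⁅a i, a j⁆ ⊗ₜ[k] b i) ⊗ₜ[k] b j
          + (a i ⊗ₜ[k] ⁅b i, a j⁆) ⊗ₜ[k] b j
          + (a i ⊗ₜ[k] a j) ⊗ₜ[k] ⁅b i, b j⁆)
      = (0 : (L ⊗[k] L) ⊗[k] L))
    (hinv : ∀ X : L, ∑ i,
        (⁅X, a i⁆ ⊗ₜ[k] b i + a i ⊗ₜ[k] ⁅X, b i⁆
          + ⁅X, b i⁆ ⊗ₜ[k] a i + b i ⊗ₜ[k] ⁅X, a i⁆)
      = (0 : L ⊗[k] L)) :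
    ∀ ξ η : Module.Dual k L,
      rPlus k L r (dualBracket k L r ξ η) = ⁅rPlus k L r ξ, rPlus k L r η⁆ ∧
      rMinus k L r (dualBracket k L r ξ η) = ⁅rMinus k L r ξ, rMinus k L r η⁆ := by
  intro ξ η
  subst hr
  constructor
  · have h := congrArg (fun t => TensorProduct.lid k L
      (TensorProduct.map (LinearMap.mul' k k ∘ₗ TensorProduct.map ξ η) LinearMap.id t)) hCYBE
    simp only [map_sum, map_add, map_zero, TensorProduct.map_tmul, LinearMap.comp_apply,
      LinearMap.mul'_apply, LinearMap.id_apply, TensorProduct.lid_tmul] at h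
    simp only [rPlus_sum_tmul, dualBracket_sum_tmul_apply, sum_lie, lie_sum, smul_lie,
      lie_smul, neg_smul, Finset.sum_smul, Finset.smul_sum, Finset.sum_neg_distrib, smul_smul]
    rw [neg_eq_iff_add_eq_zero, ← h]
    conv_lhs => enter [1]; rw [Finset.sum_comm]
    conv_lhs => enter [2]; rw [Finset.sum_comm]
    simp only [← Finset.sum_add_distrib]
    refine Finset.sum_congr rfl fun i _ => Finset.sum_congr rfl fun j _ => ?_
    module
  · have h := congrArg (fun t => TensorProduct.rid k L
      (TensorProduct.map LinearMap.id (LinearMap.mul' k k ∘ₗ TensorProduct.map ξ η)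
        (TensorProduct.assoc k L L L t))) hCYBE
    simp only [map_sum, map_add, map_zero, TensorProduct.assoc_tmul, TensorProduct.map_tmul,
      LinearMap.comp_apply, LinearMap.mul'_apply, LinearMap.id_apply,
      TensorProduct.rid_tmul] at h
    simp only [rMinus_sum_tmul, dualBracket_sum_tmul_apply, sum_lie, lie_sum, smul_lie, lie_smul,
      neg_lie, lie_neg, neg_neg, neg_smul, smul_neg, Finset.sum_smul, Finset.smul_sum,
      Finset.sum_neg_distrib, smul_smul]
    rw [← sub_eq_zero, ← neg_eq_zero, neg_sub, ← h]
    conv_lhs => enter [1]; rw [Finset.sum_comm]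
    simp only [← Finset.sum_sub_distrib]
    refine Finset.sum_congr rfl fun i _ => Finset.sum_congr rfl fun j _ => ?_
    rw [← lie_skew (b j) (b i), ← lie_skew (a j) (b i), map_neg, map_neg]
    module
end

section
/- Let Fₙ be the free group on generators x₁,…,xₙ. For 1 ≤ i ≤ n−1 let σᵢ be the endomorphism of Fₙ determined by σᵢ(xᵢ) = xᵢ₊₁, σᵢ(xᵢ₊₁) = xᵢ₊₁⁻¹ xᵢ xᵢ₊₁, and σᵢ(xⱼ) = xⱼ for j ≠ i, i+1. Then each σᵢ is an automorphism of Fₙ, and the σᵢ satisfy the braid relations: σᵢ σⱼ = σⱼ σᵢ for |i−j| > 1 and σᵢ σᵢ₊₁ σᵢ = σᵢ₊₁ σᵢ σᵢ₊₁. Hence the assignment bᵢ ↦ σᵢ defines a homomorphism (the Artin representation) from the braid group Bₙ to Aut(Fₙ). -/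
/-- The Artin generator `σᵢ` of the braid action on the free group `Fₙ`:
`xᵢ ↦ xᵢ₊₁`, `xᵢ₊₁ ↦ xᵢ₊₁⁻¹ xᵢ xᵢ₊₁`, `xⱼ ↦ xⱼ` otherwise. -/
def artinGen (n i : ℕ) (h : i + 1 < n) :
    FreeGroup (Fin n) →* FreeGroup (Fin n) :=
  FreeGroup.lift fun j =>
    if j = (⟨i, by omega⟩ : Fin n) then FreeGroup.of ⟨i + 1, h⟩
    else if j = (⟨i + 1, h⟩ : Fin n) then
      (FreeGroup.of ⟨i + 1, h⟩)⁻¹ * FreeGroup.of ⟨i, by omega⟩ * FreeGroup.of ⟨i + 1, h⟩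
    else FreeGroup.of j

/-- The braid relators: `bᵢbⱼ(bⱼbᵢ)⁻¹` for `|i - j| > 1` and
`bᵢbᵢ₊₁bᵢ(bᵢ₊₁bᵢbᵢ₊₁)⁻¹`; the braid group `Bₙ` is the group presented by
generators `b₁, …, b_{n-1}` and these relations. -/
def braidRels (n : ℕ) : Set (FreeGroup (Fin (n - 1))) :=
  {w | ∃ i j : Fin (n - 1), (i : ℕ) + 1 < (j : ℕ) ∧
        w = FreeGroup.of i * FreeGroup.of j * (FreeGroup.of j * FreeGroup.of i)⁻¹} ∪
  {w | ∃ i j : Fin (n - 1), (i : ℕ) + 1 = (j : ℕ) ∧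
        w = FreeGroup.of i * FreeGroup.of j * FreeGroup.of i *
          (FreeGroup.of j * FreeGroup.of i * FreeGroup.of j)⁻¹}

theorem artinGen_of_left {n i : ℕ} (h : i + 1 < n) :
    artinGen n i h (FreeGroup.of ⟨i, by omega⟩) = FreeGroup.of ⟨i + 1, h⟩ := by
  simp [artinGen]

theorem artinGen_of_right {n i : ℕ} (h : i + 1 < n) :
    artinGen n i h (FreeGroup.of ⟨i + 1, h⟩) =
      (FreeGroup.of ⟨i + 1, h⟩)⁻¹ * FreeGroup.of ⟨i, by omega⟩ * FreeGroup.of ⟨i + 1, h⟩ := by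
  simp [artinGen]

theorem artinGen_of_ne {n i k : ℕ} (h : i + 1 < n) (hk : k < n) (h₁ : k ≠ i) (h₂ : k ≠ i + 1) :
    artinGen n i h (FreeGroup.of ⟨k, hk⟩) = FreeGroup.of ⟨k, hk⟩ := by
  simp [artinGen, h₁, h₂]

/-- The inverse of `artinGen n i h`: `xᵢ ↦ xᵢ xᵢ₊₁ xᵢ⁻¹`, `xᵢ₊₁ ↦ xᵢ`, `xⱼ ↦ xⱼ` otherwise. -/
def artinGenInv (n i : ℕ) (h : i + 1 < n) : FreeGroup (Fin n) →* FreeGroup (Fin n) :=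
  FreeGroup.lift fun j =>
    if j = (⟨i, by omega⟩ : Fin n) then
      FreeGroup.of ⟨i, by omega⟩ * FreeGroup.of ⟨i + 1, h⟩ * (FreeGroup.of ⟨i, by omega⟩)⁻¹
    else if j = (⟨i + 1, h⟩ : Fin n) then FreeGroup.of ⟨i, by omega⟩
    else FreeGroup.of j

theorem artinGenInv_comp_artinGen {n i : ℕ} (h : i + 1 < n) :
    (artinGenInv n i h).comp (artinGen n i h) = MonoidHom.id _ := by
  ext ⟨k, hk⟩
  rcases eq_or_ne k i with rfl | h₁
  · simp [artinGen, artinGenInv]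
  rcases eq_or_ne k (i + 1) with rfl | h₂
  · simp [artinGen, artinGenInv, mul_assoc]
  · simp [artinGen, artinGenInv, h₁, h₂]

theorem artinGen_comp_artinGenInv {n i : ℕ} (h : i + 1 < n) :
    (artinGen n i h).comp (artinGenInv n i h) = MonoidHom.id _ := by
  ext ⟨k, hk⟩
  rcases eq_or_ne k i with rfl | h₁
  · simp [artinGen, artinGenInv, mul_assoc]
  rcases eq_or_ne k (i + 1) with rfl | h₂
  · simp [artinGen, artinGenInv]
  · simp [artinGen, artinGenInv, h₁, h₂]

/-- The Artin generator as an automorphism of the free group. -/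
def artinAut (n i : ℕ) (h : i + 1 < n) : MulAut (FreeGroup (Fin n)) :=
  (artinGen n i h).toMulEquiv (artinGenInv n i h)
    (artinGenInv_comp_artinGen h) (artinGen_comp_artinGenInv h)

theorem artinGen_comm_of_lt {n i j : ℕ} (hi : i + 1 < n) (hj : j + 1 < n) (hij : i + 1 < j) :
    (artinGen n i hi).comp (artinGen n j hj) = (artinGen n j hj).comp (artinGen n i hi) := by
  have hii := artinGen_of_ne hj (k := i) (by omega) (by omega) (by omega)
  have hii' := artinGen_of_ne hj hi (by omega) (by omega)
  have hjj := artinGen_of_ne hi (k := j) (by omega) (by omega) (by omega)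
  have hjj' := artinGen_of_ne hi hj (by omega) (by omega)
  ext ⟨k, hk⟩
  simp only [MonoidHom.comp_apply]
  rcases eq_or_ne k i with rfl | h₁
  · simp only [hii, hii', artinGen_of_left]
  rcases eq_or_ne k (i + 1) with rfl | h₂
  · simp only [hii, hii', artinGen_of_right, map_mul, map_inv]
  rcases eq_or_ne k j with rfl | h₃
  · simp only [hjj, hjj', artinGen_of_left]
  rcases eq_or_ne k (j + 1) with rfl | h₄
  · simp only [hjj, hjj', artinGen_of_right, map_mul, map_inv]
  · simp only [artinGen_of_ne hi hk h₁ h₂, artinGen_of_ne hj hk h₃ h₄]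

theorem artinGen_braid {n i : ℕ} (h : i + 1 < n) (h' : i + 1 + 1 < n) :
    (artinGen n i h).comp ((artinGen n (i + 1) h').comp (artinGen n i h))
      = (artinGen n (i + 1) h').comp ((artinGen n i h).comp (artinGen n (i + 1) h')) := by
  have hl := artinGen_of_ne h h' (by omega) (by omega)
  have hr := artinGen_of_ne h' (k := i) (by omega) (by omega) (by omega)
  have hm := artinGen_of_left h
  have hm' := artinGen_of_right h
  have hn := artinGen_of_left h'
  have hn' := artinGen_of_right h'
  ext ⟨k, hk⟩
  simp only [MonoidHom.comp_apply]
  rcases eq_or_ne k i with rfl | h₁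
  · simp only [hl, hr, hm, hn]
  rcases eq_or_ne k (i + 1) with rfl | h₂
  · simp only [hl, hr, hm, hm', hn, hn', map_mul, map_inv]
  rcases eq_or_ne k (i + 2) with rfl | h₃
  · simp only [hl, hr, hm', hn, hn', map_mul, map_inv]
    group
  · have hi := artinGen_of_ne h hk h₁ h₂
    have hj := artinGen_of_ne h' hk h₂ h₃
    simp only [hi, hj]

/-- Each `σᵢ` is an automorphism of `Fₙ`, the `σᵢ` satisfy the braid relations,
and hence `bᵢ ↦ σᵢ` defines a homomorphism (the Artin representation) from the
braid group `Bₙ` to `Aut(Fₙ)`. -/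
theorem artin_representation (n : ℕ) :
    (∀ i (h : i + 1 < n), Function.Bijective (artinGen n i h)) ∧
    (∀ i j (hi : i + 1 < n) (hj : j + 1 < n), (i + 1 < j ∨ j + 1 < i) →
      (artinGen n i hi).comp (artinGen n j hj)
        = (artinGen n j hj).comp (artinGen n i hi)) ∧
    (∀ i (h : i + 2 < n),
      (artinGen n i (by omega)).comp
          ((artinGen n (i + 1) (by omega)).comp (artinGen n i (by omega)))
        = (artinGen n (i + 1) (by omega)).comp
            ((artinGen n i (by omega)).comp (artinGen n (i + 1) (by omega)))) ∧
    (∃ Φ : PresentedGroup (braidRels n) →* MulAut (FreeGroup (Fin n)),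
      ∀ i : Fin (n - 1),
        ⇑(Φ (PresentedGroup.of i)) = ⇑(artinGen n i (by have := i.isLt; omega))) := by
  refine ⟨fun i h => (artinAut n i h).bijective, ?_, fun i h => artinGen_braid _ _, ?_⟩
  · rintro i j hi hj (hij | hij)
    · exact artinGen_comm_of_lt hi hj hij
    · exact (artinGen_comm_of_lt hj hi hij).symm
  · let f : Fin (n - 1) → MulAut (FreeGroup (Fin n)) := fun i => artinAut n i (by omega)
    have hf : ∀ r ∈ braidRels n, FreeGroup.lift f r = 1 := by
      rintro r (⟨i, j, hij, rfl⟩ | ⟨i, ⟨j, hj⟩, hij, rfl⟩)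
      · simp only [map_mul, map_inv, FreeGroup.lift_apply_of, mul_inv_eq_one]
        exact MulEquiv.ext fun x => DFunLike.congr_fun (artinGen_comm_of_lt _ _ hij) x
      · obtain rfl : (i : ℕ) + 1 = j := hij
        simp only [map_mul, map_inv, FreeGroup.lift_apply_of, mul_inv_eq_one]
        exact MulEquiv.ext fun x => DFunLike.congr_fun (artinGen_braid _ _) x
    refine ⟨PresentedGroup.toGroup hf, fun i => ?_⟩
    rw [PresentedGroup.toGroup.of]
    rfl
end

section
/- Let (Δ, ▷) be a quandle (an automorphic set with a ▷ a = a for all a). For m ≥ 2 and 1 ≤ i ≤ m−1, let R̂ᵢ(m) : Δᵐ → Δᵐ be the bijection applying the rack braiding R̂ (obtained from R(a,b) = (a, a ▷ b) by composing with the exchange of components) to the i-th and (i+1)-st coordinates, so that bᵢ ↦ R̂ᵢ(m) defines an action β of the braid group Bₘ on Δᵐ. Then the invariants are unchanged under both Markov moves: (1) for any A, B ∈ Bₙ, the fixed point sets of β(A) and β(B A B⁻¹) on Δⁿ are in bijection; (2) for any A ∈ Bₙ, regarding A as an element of Bₙ₊₁ via the standard inclusion, the fixed point set of β(A·bₙ^{±1})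 on Δⁿ⁺¹ is in bijection with the fixed point set of β(A) on Δⁿ. -/
variable {Δ : Type*}

/-- Apply a map of pairs to the coordinates `i, i+1` of `Δⁿ` and the identity
to all other coordinates. -/
def applyAt (F : Δ × Δ → Δ × Δ) (n i : ℕ) (h : i + 1 < n) :
    (Fin n → Δ) → (Fin n → Δ) := fun f =>
  Function.update (Function.update f ⟨i, by omega⟩
      (F (f ⟨i, by omega⟩, f ⟨i + 1, h⟩)).1) ⟨i + 1, h⟩
    (F (f ⟨i, by omega⟩, f ⟨i + 1, h⟩)).2

/-- The rack braiding `R̂ = R ∘ σ`, where `R(a,b) = (a, a ▷ b)` and `σ` is the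
exchange of components: `R̂(x, y) = (y, y ▷ x)`. -/
def rackRhat (op : Δ → Δ → Δ) : Δ × Δ → Δ × Δ := fun p => (p.2, op p.2 p.1)

/-- The inverse of the rack braiding, expressed via the inverse `op'` of the
left translations: `R̂⁻¹(u, v) = (u ▷'⁻¹ v, u)`. -/
def rackRhatInv (op' : Δ → Δ → Δ) : Δ × Δ → Δ × Δ := fun p => (op' p.1 p.2, p.1)

/-- The action of a signed braid generator `bᵢ^{±1}` (encoded as `(i, e)` with
`e : Bool` the sign) on `Δⁿ`. -/
def stepAct (op op' : Δ → Δ → Δ) (n : ℕ) (p : ℕ × Bool) :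
    (Fin n → Δ) → (Fin n → Δ) :=
  if h : p.1 + 1 < n then
    (if p.2 then applyAt (rackRhat op) n p.1 h else applyAt (rackRhatInv op') n p.1 h)
  else id

/-- The action `β` of a braid word (a list of signed generators) on `Δⁿ`. -/
def wordAct (op op' : Δ → Δ → Δ) (n : ℕ) (w : List (ℕ × Bool)) :
    (Fin n → Δ) → (Fin n → Δ) :=
  w.foldr (fun p F => stepAct op op' n p ∘ F) id

/-- The inverse of a braid word. -/
def invWord (w : List (ℕ × Bool)) : List (ℕ × Bool) :=
  w.reverse.map fun p => (p.1, !p.2)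

theorem applyAt_leftInverse {F G : Δ × Δ → Δ × Δ} (hFG : Function.LeftInverse F G)
    (n i : ℕ) (h : i + 1 < n) :
    Function.LeftInverse (applyAt F n i h) (applyAt G n i h) := by
  intro f
  have hne : (⟨i, by omega⟩ : Fin n) ≠ ⟨i + 1, h⟩ := by simp
  funext j
  by_cases hj₁ : j = ⟨i + 1, h⟩
  · subst hj₁
    simp [applyAt, hFG _]
  by_cases hj₀ : j = ⟨i, by omega⟩
  · subst hj₀
    simp [applyAt, hFG _]
  simp [applyAt, hj₀, hj₁]

theorem applyAt_snoc (F : Δ × Δ → Δ × Δ) (n i : ℕ) (h : i + 1 < n)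
    (g : Fin n → Δ) (y : Δ) :
    applyAt F (n + 1) i (by omega) (Fin.snoc g y : Fin (n + 1) → Δ) =
      (Fin.snoc (applyAt F n i h g) y : Fin (n + 1) → Δ) := by
  have h₀ : (⟨i, by omega⟩ : Fin (n + 1)) = Fin.castSucc ⟨i, by omega⟩ := rfl
  have h₁ : (⟨i + 1, by omega⟩ : Fin (n + 1)) = Fin.castSucc ⟨i + 1, h⟩ := rfl
  simp only [applyAt, h₀, h₁, Fin.snoc_castSucc, Fin.snoc_update]

theorem applyAt_eq_self {F : Δ × Δ → Δ × Δ} {n i : ℕ} (h : i + 1 < n) {f : Fin n → Δ}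
    (hF : F (f ⟨i, by omega⟩, f ⟨i + 1, h⟩) = (f ⟨i, by omega⟩, f ⟨i + 1, h⟩)) :
    applyAt F n i h f = f := by
  simp [applyAt, hF]

theorem stepAct_snoc (op op' : Δ → Δ → Δ) (n : ℕ) (p : ℕ × Bool) (h : p.1 + 1 < n)
    (g : Fin n → Δ) (y : Δ) :
    stepAct op op' (n + 1) p (Fin.snoc g y : Fin (n + 1) → Δ) =
      (Fin.snoc (stepAct op op' n p g) y : Fin (n + 1) → Δ) := by
  have h' : p.1 + 1 < n + 1 := by omega
  simp only [stepAct, h, h', dite_true]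
  split <;> exact applyAt_snoc _ n p.1 h g y

theorem stepAct_leftInverse {op op' : Δ → Δ → Δ}
    (hinv₁ : ∀ a b, op' a (op a b) = b) (hinv₂ : ∀ a b, op a (op' a b) = b)
    (n : ℕ) (p : ℕ × Bool) :
    Function.LeftInverse (stepAct op op' n (p.1, !p.2)) (stepAct op op' n p) := by
  obtain ⟨i, e⟩ := p
  by_cases h : i + 1 < n
  · cases e
    · simpa [stepAct, h] using
        applyAt_leftInverse (F := rackRhat op) (G := rackRhatInv op')
          (fun q => by simp [rackRhat, rackRhatInv, hinv₂]) n i h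
    · simpa [stepAct, h] using
        applyAt_leftInverse (F := rackRhatInv op') (G := rackRhat op)
          (fun q => by simp [rackRhat, rackRhatInv, hinv₁]) n i h
  · intro f
    simp [stepAct, h]

theorem wordAct_cons (op op' : Δ → Δ → Δ) (n : ℕ) (p : ℕ × Bool) (w : List (ℕ × Bool))
    (f : Fin n → Δ) :
    wordAct op op' n (p :: w) f = stepAct op op' n p (wordAct op op' n w f) := rfl

theorem wordAct_append (op op' : Δ → Δ → Δ) (n : ℕ) (v w : List (ℕ × Bool))
    (f : Fin n → Δ) :
    wordAct op op' n (v ++ w) f = wordAct op op' n v (wordAct op op' n w f) := by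
  induction v with
  | nil => rfl
  | cons p v ih => rw [List.cons_append, wordAct_cons, ih, wordAct_cons]

theorem invWord_cons (p : ℕ × Bool) (w : List (ℕ × Bool)) :
    invWord (p :: w) = invWord w ++ [(p.1, !p.2)] := by
  simp [invWord]

theorem invWord_invWord (w : List (ℕ × Bool)) : invWord (invWord w) = w := by
  simp [invWord, Function.comp_def]

theorem wordAct_invWord_leftInverse {op op' : Δ → Δ → Δ}
    (hinv₁ : ∀ a b, op' a (op a b) = b) (hinv₂ : ∀ a b, op a (op' a b) = b)
    (n : ℕ) (w : List (ℕ × Bool)) :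
    Function.LeftInverse (wordAct op op' n (invWord w)) (wordAct op op' n w) := by
  induction w with
  | nil => exact fun _ => rfl
  | cons p w ih =>
    intro f
    rw [invWord_cons, wordAct_append, wordAct_cons, wordAct_cons]
    exact (congrArg _ (stepAct_leftInverse hinv₁ hinv₂ n p _)).trans (ih f)

/-- A braid word as a permutation of `Δⁿ`. -/
def wordEquiv {op op' : Δ → Δ → Δ}
    (hinv₁ : ∀ a b, op' a (op a b) = b) (hinv₂ : ∀ a b, op a (op' a b) = b)
    (n : ℕ) (w : List (ℕ × Bool)) : Equiv.Perm (Fin n → Δ) where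
  toFun := wordAct op op' n w
  invFun := wordAct op op' n (invWord w)
  left_inv := wordAct_invWord_leftInverse hinv₁ hinv₂ n w
  right_inv f := by
    simpa only [invWord_invWord] using
      wordAct_invWord_leftInverse hinv₁ hinv₂ n (invWord w) f

theorem wordAct_snoc (op op' : Δ → Δ → Δ) (n : ℕ) (w : List (ℕ × Bool))
    (hw : ∀ p ∈ w, p.1 + 1 < n) (g : Fin n → Δ) (y : Δ) :
    wordAct op op' (n + 1) w (Fin.snoc g y : Fin (n + 1) → Δ) =
      (Fin.snoc (wordAct op op' n w g) y : Fin (n + 1) → Δ) := by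
  induction w with
  | nil => rfl
  | cons p w ih =>
    rw [List.forall_mem_cons] at hw
    rw [wordAct_cons, ih hw.2, stepAct_snoc _ _ _ _ hw.1, wordAct_cons]

theorem wordAct_apply_last (op op' : Δ → Δ → Δ) (n : ℕ) (w : List (ℕ × Bool))
    (hw : ∀ p ∈ w, p.1 + 1 < n) (f : Fin (n + 1) → Δ) :
    wordAct op op' (n + 1) w f (Fin.last n) = f (Fin.last n) := by
  rw [← Fin.snoc_init_self f, wordAct_snoc op op' n w hw, Fin.snoc_last, Fin.snoc_last]

/-- If the last coordinate of `Δᵐ⁺²` is unchanged by the last generator or its inverse, then the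
last two coordinates agree. -/
theorem eq_of_stepAct_apply_last {op op' : Δ → Δ → Δ}
    (hinv₁ : ∀ a b, op' a (op a b) = b) (hidem : ∀ a, op a a = a) {m : ℕ} {e : Bool}
    {f : Fin (m + 2) → Δ}
    (h : stepAct op op' (m + 2) (m, e) f (Fin.last (m + 1)) = f (Fin.last (m + 1))) :
    f (Fin.last m).castSucc = f (Fin.last (m + 1)) := by
  have hl : (⟨m + 1, by omega⟩ : Fin (m + 2)) = Fin.last (m + 1) := rfl
  have hc : (⟨m, by omega⟩ : Fin (m + 2)) = (Fin.last m).castSucc := rfl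
  cases e
  · simpa [stepAct, applyAt, rackRhatInv, hl, hc] using h
  · have h' : op (f (Fin.last (m + 1))) (f (Fin.last m).castSucc) = f (Fin.last (m + 1)) := by
      simpa [stepAct, applyAt, rackRhat, hl, hc] using h
    rw [← hinv₁ (f (Fin.last (m + 1))) (f (Fin.last m).castSucc), h']
    nth_rewrite 2 [← hidem (f (Fin.last (m + 1)))]
    exact hinv₁ _ _

theorem stepAct_eq_self {op op' : Δ → Δ → Δ}
    (hinv₁ : ∀ a b, op' a (op a b) = b) (hidem : ∀ a, op a a = a) {m : ℕ} (e : Bool)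
    {f : Fin (m + 2) → Δ} (h : f (Fin.last m).castSucc = f (Fin.last (m + 1))) :
    stepAct op op' (m + 2) (m, e) f = f := by
  have hidem' (a : Δ) : op' a a = a := by simpa only [hidem] using hinv₁ a a
  have h' : f ⟨m, by omega⟩ = f ⟨m + 1, by omega⟩ := h
  have hm : m + 1 < m + 2 := by omega
  cases e
  · simpa [stepAct] using applyAt_eq_self (F := rackRhatInv op') hm
      (by simp [rackRhatInv, h', hidem'])
  · simpa [stepAct] using applyAt_eq_self (F := rackRhat op) hm
      (by simp [rackRhat, h', hidem])

theorem wordAct_stabilization_eq_self_iff {op op' : Δ → Δ → Δ}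
    (hinv₁ : ∀ a b, op' a (op a b) = b) (hidem : ∀ a, op a a = a) {m : ℕ}
    {w : List (ℕ × Bool)} (hw : ∀ p ∈ w, p.1 + 1 < m + 1) (e : Bool)
    (g : Fin (m + 1) → Δ) (y : Δ) :
    wordAct op op' (m + 2) (w ++ [(m, e)]) (Fin.snoc g y : Fin (m + 2) → Δ) =
        (Fin.snoc g y : Fin (m + 2) → Δ) ↔
      g (Fin.last m) = y ∧ wordAct op op' (m + 1) w g = g := by
  have hstep : wordAct op op' (m + 2) (w ++ [(m, e)]) (Fin.snoc g y : Fin (m + 2) → Δ) =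
      wordAct op op' (m + 2) w (stepAct op op' (m + 2) (m, e) (Fin.snoc g y)) :=
    wordAct_append op op' (m + 2) w [(m, e)] _
  rw [hstep]
  have key (hgy : g (Fin.last m) = y) :
      stepAct op op' (m + 2) (m, e) (Fin.snoc g y : Fin (m + 2) → Δ) =
        (Fin.snoc g y : Fin (m + 2) → Δ) :=
    stepAct_eq_self hinv₁ hidem e (by simpa using hgy)
  constructor
  · intro h
    have hgy : g (Fin.last m) = y := by
      have hlast := congrFun h (Fin.last (m + 1))
      rw [wordAct_apply_last op op' (m + 1) w hw] at hlast
      simpa using eq_of_stepAct_apply_last hinv₁ hidem hlast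
    rw [key hgy, wordAct_snoc op op' (m + 1) w hw] at h
    exact ⟨hgy, (Fin.snoc_injective2 h).1⟩
  · rintro ⟨hgy, hg⟩
    rw [key hgy, wordAct_snoc op op' (m + 1) w hw, hg]

/-- For a quandle `(Δ, ▷)` (with `op'` the inverse of the left translations),
the fixed point sets of the braid action on `Δⁿ` are unchanged, up to
bijection, under both Markov moves: conjugation `A ↦ B A B⁻¹` and
stabilization `A ↦ A · bₙ^{±1}` (where `A ∈ Bₙ` is regarded in `Bₙ₊₁` and `bₙ`
is the `n`-th generator of `Bₙ₊₁`). -/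
theorem quandle_markov_invariance (op op' : Δ → Δ → Δ)
    (hinv₁ : ∀ a b, op' a (op a b) = b) (hinv₂ : ∀ a b, op a (op' a b) = b)
    (hdist : ∀ a b c, op a (op b c) = op (op a b) (op a c))
    (hidem : ∀ a, op a a = a) :
    (∀ (n : ℕ) (A B : List (ℕ × Bool)),
      (∀ p ∈ A, p.1 + 1 < n) → (∀ p ∈ B, p.1 + 1 < n) →
      Nonempty ({f : Fin n → Δ // wordAct op op' n A f = f} ≃
        {f : Fin n → Δ // wordAct op op' n (B ++ A ++ invWord B) f = f})) ∧
    (∀ (n : ℕ) (A : List (ℕ × Bool)), 1 ≤ n → (∀ p ∈ A, p.1 + 1 < n) →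
      ∀ e : Bool,
      Nonempty ({f : Fin (n + 1) → Δ //
          wordAct op op' (n + 1) (A ++ [(n - 1, e)]) f = f} ≃
        {f : Fin n → Δ // wordAct op op' n A f = f})) := by
  refine ⟨fun n A B _ _ => ?_, fun n A hn hA e => ?_⟩
  · refine ⟨(wordEquiv hinv₁ hinv₂ n B).subtypeEquiv fun f => ?_⟩
    change _ ↔ wordAct op op' n (B ++ A ++ invWord B) (wordAct op op' n B f) =
      wordAct op op' n B f
    rw [wordAct_append, wordAct_append, wordAct_invWord_leftInverse hinv₁ hinv₂ n B f]
    exact (wordEquiv hinv₁ hinv₂ n B).injective.eq_iff.symm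
  · obtain ⟨m, rfl⟩ : ∃ m, n = m + 1 := ⟨n - 1, by omega⟩
    have fixed_iff := wordAct_stabilization_eq_self_iff (op' := op') hinv₁ hidem hA e
    have fixed_init (f : Fin (m + 2) → Δ)
        (hf : wordAct op op' (m + 2) (A ++ [(m, e)]) f = f) :=
      (fixed_iff (Fin.init f) (f (Fin.last (m + 1)))).1 (by rwa [Fin.snoc_init_self])
    exact ⟨{
      toFun := fun f => ⟨Fin.init f.1, (fixed_init f.1 f.2).2⟩
      invFun := fun g => ⟨Fin.snoc g.1 (g.1 (Fin.last m)), (fixed_iff _ _).2 ⟨rfl, g.2⟩⟩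
      left_inv := fun f => Subtype.ext <| by
        change (Fin.snoc (Fin.init f.1) (Fin.init f.1 (Fin.last m)) : Fin (m + 2) → Δ) = f.1
        rw [(fixed_init f.1 f.2).1, Fin.snoc_init_self]
      right_inv := fun g => Subtype.ext <| by
        change Fin.init (Fin.snoc g.1 (g.1 (Fin.last m)) : Fin (m + 2) → Δ) = g.1
        exact Fin.init_snoc (α := fun _ => Δ) _ _ }⟩
end
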